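/- Let u ∈ 𝒜_ε and let ℰ_ε(u,I) denote the part of the energy ℰ_ε(u) given by all unordered nearest-neighbour pairs having at least one endpoint in I, each pair counted once. Then: (i) ℰ_ε(u, Z_u) = 2ε(1−k)·#Z_u + (1/2)(1−k)·Per(Z_u). (ii) If moreover Z_u ∪ I_u has a strongly connected component G with ∂⁻G ⊂ Z_u, and I_u ∩ G = ∪_{i=1}^n B_i with B_i the strongly connected components of I_u ∩ G, then ℰ_ε(u, G) = 2ε(1−k)·#(G ∩ Z_u) + (1/2)(1−k)·(Per(G) + Σ_{i=1}^n Per(B_i)). -/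

import Mathlib

open scoped ENNReal symmDiff Classical
open MeasureTheory

namespace BEG

/-- Lattice points (the lattice `εℤ²` in lattice units). -/
abbrev Pt : Type := ℤ × ℤ

/-- Lattice `ℓ¹` distance (in lattice units). -/
def d1 (p q : Pt) : ℕ := (p.1 - q.1).natAbs + (p.2 - q.2).natAbs

/-- Lattice `ℓ∞` distance (in lattice units). -/
def dinf (p q : Pt) : ℕ := max (p.1 - q.1).natAbs (p.2 - q.2).natAbs

/-- The four nearest neighbours `𝒩(p)`. -/
def nbrs (p : Pt) : Set Pt := {q | d1 p q = 1}

/-- Combinatorial `ℓ¹` distance from a point to a set (in lattice units). -/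
noncomputable def distTo (p : Pt) (S : Set Pt) : ℝ≥0∞ := ⨅ q ∈ S, ((d1 p q : ℕ) : ℝ≥0∞)

/-- Combinatorial distance to the (discrete) boundary of `I`, in lattice units;
the physical distance `d₁^ε(p,∂I)` is `ε * dB p I`. -/
noncomputable def dB (p : Pt) (I : Set Pt) : ℝ≥0∞ :=
  if p ∈ I then distTo p Iᶜ else distTo p I

/-- The exterior boundary `∂⁺I`. -/
def bdryOut (I : Set Pt) : Set Pt := {p | p ∉ I ∧ dB p I = 1}
/-- The interior boundary `∂⁻I`. -/
def bdryIn (I : Set Pt) : Set Pt := {p | p ∈ I ∧ dB p I = 1}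

/-- `𝕆 I = {p ∈ ∂⁺I : #(𝒩(p) ∩ I) = 2}`. -/
def Ocorner (I : Set Pt) : Set Pt := {p ∈ bdryOut I | (nbrs p ∩ I).ncard = 2}
/-- `𝕀 I = {p ∈ ∂⁻I : #(𝒩(p) ∩ I) = 2}`. -/
def Icorner (I : Set Pt) : Set Pt := {p ∈ bdryIn I | (nbrs p ∩ I).ncard = 2}

/-- Spin configurations `𝒜_ε`: maps `εℤ² → {-1,0,1}` with finitely many zeros. -/
structure Config where
  val : Pt → ℤ
  val_mem : ∀ p, val p = -1 ∨ val p = 0 ∨ val p = 1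
  finiteZero : {p | val p = 0}.Finite

/-- `I_u = {u = 1}`. -/
def Iset (u : Config) : Set Pt := {p | u.val p = 1}
/-- `Z_u = {u = 0}`. -/
def Zset (u : Config) : Set Pt := {p | u.val p = 0}

/-- Energy of one nearest-neighbour bond: `ε (1 - ab - k (1 - (ab)²))`. -/
noncomputable def bond (ε k : ℝ) (a b : ℤ) : ℝ≥0∞ :=
  ENNReal.ofReal (ε * (1 - (a : ℝ) * (b : ℝ) - k * (1 - ((a : ℝ) * (b : ℝ)) ^ 2)))

/-- The energy `ℰ_ε(u)`: the sum over unordered nearest-neighbour pairs. -/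
noncomputable def energy (ε k : ℝ) (u : Config) : ℝ≥0∞ :=
  ∑' p : Pt, (bond ε k (u.val p) (u.val (p + (1, 0))) + bond ε k (u.val p) (u.val (p + (0, 1))))

/-- The local energy `ℰ_ε(u, I)`: bonds with at least one endpoint in `I`, each counted once. -/
noncomputable def localEnergy (ε k : ℝ) (u : Config) (I : Set Pt) : ℝ≥0∞ :=
  ∑' p : Pt,
    ((if p ∈ I ∨ p + (1, 0) ∈ I then bond ε k (u.val p) (u.val (p + (1, 0))) else 0) +
     (if p ∈ I ∨ p + (0, 1) ∈ I then bond ε k (u.val p) (u.val (p + (0, 1))) else 0))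

/-- The dissipation `𝒟¹_ε(I_u, I_w) = Σ_{p ∈ I_u △ I_w} ε² d₁^ε(p, ∂I_w)`
(each summand is `ε² ⋅ ε ⋅ dB`). -/
noncomputable def diss1 (ε : ℝ) (Iu Iw : Set Pt) : ℝ≥0∞ :=
  ∑' p : Pt, if p ∈ Iu ∆ Iw then ENNReal.ofReal (ε ^ 3) * dB p Iw else 0

/-- The dissipation `𝒟⁰_ε(Z_u, Z_w) = |#Z_u - #Z_w|`. -/
noncomputable def diss0 (Zu Zw : Set Pt) : ℝ≥0∞ := ((Nat.dist Zu.ncard Zw.ncard : ℕ) : ℝ≥0∞)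

/-- The total functional `ℱ^{τ,γ}_ε(u,w)` with `τ = ζ ε`. -/
noncomputable def totalF (ε k ζ γ : ℝ) (u w : Config) : ℝ≥0∞ :=
  energy ε k u + (ENNReal.ofReal (ζ * ε))⁻¹ *
    (diss1 ε (Iset u) (Iset w) + ENNReal.ofReal (ε ^ γ) * diss0 (Zset u) (Zset w))

/-- `u₁` is a minimizer of `u ↦ ℱ^{τ,γ}_ε(u, u₀)`. -/
def Minimizes (ε k ζ γ : ℝ) (u₁ u₀ : Config) : Prop :=
  ∀ v : Config, totalF ε k ζ γ u₁ u₀ ≤ totalF ε k ζ γ v u₀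

/-- One step of a strongly continuous path inside `S`. -/
def stStep (S : Set Pt) (a b : Pt) : Prop := a ∈ S ∧ b ∈ S ∧ d1 a b = 1
/-- One step of a weakly continuous path inside `S`. -/
def wkStep (S : Set Pt) (a b : Pt) : Prop := a ∈ S ∧ b ∈ S ∧ dinf a b = 1

def StronglyConnected (S : Set Pt) : Prop :=
  ∀ p ∈ S, ∀ q ∈ S, Relation.ReflTransGen (stStep S) p q
def WeaklyConnected (S : Set Pt) : Prop :=
  ∀ p ∈ S, ∀ q ∈ S, Relation.ReflTransGen (wkStep S) p q

/-- The strongly connected component of `p` in `S`. -/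
def stComp (S : Set Pt) (p : Pt) : Set Pt := {q | Relation.ReflTransGen (stStep S) p q}
/-- The weakly connected component of `p` in `S`. -/
def wkComp (S : Set Pt) (p : Pt) : Set Pt := {q | Relation.ReflTransGen (wkStep S) p q}

def HConvex (S : Set Pt) : Prop :=
  ∀ p ∈ S, ∀ q ∈ S, p.2 = q.2 → ∀ r : Pt, r.2 = p.2 → p.1 ≤ r.1 → r.1 ≤ q.1 → r ∈ S
def VConvex (S : Set Pt) : Prop :=
  ∀ p ∈ S, ∀ q ∈ S, p.1 = q.1 → ∀ r : Pt, r.1 = p.1 → p.2 ≤ r.2 → r.2 ≤ q.2 → r ∈ S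

/-- Staircase sets: strongly connected and horizontally and vertically convex. -/
def IsStaircase (S : Set Pt) : Prop := StronglyConnected S ∧ HConvex S ∧ VConvex S

/-- Discrete rectangles. -/
def IsDiscreteRectangle (S : Set Pt) : Prop :=
  ∃ a b c d : ℤ, a ≤ b ∧ c ≤ d ∧ S = {p : Pt | a ≤ p.1 ∧ p.1 ≤ b ∧ c ≤ p.2 ∧ p.2 ≤ d}

/-- `R_S`: the smallest discrete rectangle containing `S`. -/
def Rbox (S : Set Pt) : Set Pt :=
  {p : Pt | (∃ q ∈ S, q.1 ≤ p.1) ∧ (∃ q ∈ S, p.1 ≤ q.1) ∧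
            (∃ q ∈ S, q.2 ≤ p.2) ∧ (∃ q ∈ S, p.2 ≤ q.2)}

/-- The perimeter `Per(A_I)` of the union of the `ε`-cells centred at points of `I`:
`ε` times the number of boundary edges. -/
noncomputable def perim (ε : ℝ) (I : Set Pt) : ℝ≥0∞ :=
  ENNReal.ofReal ε * (({pq : Pt × Pt | pq.1 ∈ I ∧ pq.2 ∉ I ∧ d1 pq.1 pq.2 = 1}).encard : ℝ≥0∞)

/-- `Σ_i Per(B_i)`, the sum of the perimeters of the strongly connected components of `S`. -/
noncomputable def compPerimSum (ε : ℝ) (S : Set Pt) : ℝ≥0∞ :=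
  ENNReal.ofReal ε *
    (({pq : Pt × Pt | pq.1 ∈ S ∧ pq.2 ∉ stComp S pq.1 ∧ d1 pq.1 pq.2 = 1}).encard : ℝ≥0∞)

/-- The closed `ε`-cell of side `ε` centred at the lattice point `p`. -/
def cell (ε : ℝ) (p : Pt) : Set (ℝ × ℝ) :=
  {x | |x.1 - ε * (p.1 : ℝ)| ≤ ε / 2 ∧ |x.2 - ε * (p.2 : ℝ)| ≤ ε / 2}

/-- `A_I ⊆ ℝ²`. -/
def Aset (ε : ℝ) (I : Set Pt) : Set (ℝ × ℝ) := ⋃ p ∈ I, cell ε p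

/-- `𝒞_{ε^μ}(I) = {p ∈ I : d₁^ε(p,∂I) ≤ ε^μ}`. -/
def closeLayer (ε μ : ℝ) (I : Set Pt) : Set Pt :=
  {p ∈ I | ENNReal.ofReal ε * dB p I ≤ ENNReal.ofReal (ε ^ μ)}

/-- Assumption (H): `I` is a staircase set contained in a ball of radius `Rbar`, each of whose
four extreme slices contains at least `cbar/ε` lattice points. -/
def AssumpH (cbar Rbar ε : ℝ) (I : Set Pt) : Prop :=
  IsStaircase I ∧ I.Finite ∧
  (∃ x : ℝ × ℝ, ∀ p ∈ I, (ε * (p.1 : ℝ) - x.1) ^ 2 + (ε * (p.2 : ℝ) - x.2) ^ 2 ≤ Rbar ^ 2) ∧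
  (∃ yLo yHi xLo xHi : ℤ,
    (∀ p ∈ I, yLo ≤ p.2 ∧ p.2 ≤ yHi ∧ xLo ≤ p.1 ∧ p.1 ≤ xHi) ∧
    cbar / ε ≤ ({p ∈ I | p.2 = yLo}.ncard : ℝ) ∧
    cbar / ε ≤ ({p ∈ I | p.2 = yHi}.ncard : ℝ) ∧
    cbar / ε ≤ ({p ∈ I | p.1 = xLo}.ncard : ℝ) ∧
    cbar / ε ≤ ({p ∈ I | p.1 = xHi}.ncard : ℝ))

/-- `p` is a surfactant in the corner for `u` (up to a rotation of the lattice). -/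
def SurfCorner (u : Config) (p : Pt) : Prop :=
  ∃ e : Pt, d1 p (p + e) = 1 ∧
    u.val p = 0 ∧ u.val (p + e) = 0 ∧ u.val (p + (-e.2, e.1)) = 0 ∧
    u.val (p - e) = u.val (p - (-e.2, e.1)) ∧ u.val (p - e) ≠ 0

/-- A horizontal discrete segment. -/
def segH (x₁ x₂ y : ℤ) : Set Pt := {p : Pt | p.2 = y ∧ x₁ ≤ p.1 ∧ p.1 ≤ x₂}

/-- A (possibly degenerate) octagon of the class `𝒲`, described through the positions of
its eight supporting lines: the region is
`{x : yLo ≤ x₂ ≤ yHi, xLo ≤ x₁ ≤ xHi, sLo ≤ x₁+x₂ ≤ sHi, mLo ≤ x₁-x₂ ≤ mHi}`. -/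
structure Oct where
  yLo : ℝ
  yHi : ℝ
  xLo : ℝ
  xHi : ℝ
  sLo : ℝ
  sHi : ℝ
  mLo : ℝ
  mHi : ℝ

namespace Oct

def region (O : Oct) : Set (ℝ × ℝ) :=
  {x | O.yLo ≤ x.2 ∧ x.2 ≤ O.yHi ∧ O.xLo ≤ x.1 ∧ x.1 ≤ O.xHi ∧
       O.sLo ≤ x.1 + x.2 ∧ x.1 + x.2 ≤ O.sHi ∧ O.mLo ≤ x.1 - x.2 ∧ x.1 - x.2 ≤ O.mHi}

/-- Lengths `P_i` of the four axis-parallel sides (bottom, left, top, right). -/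
noncomputable def P (O : Oct) : Fin 4 → ℝ :=
  ![max 0 (min (min O.xHi (O.sHi - O.yLo)) (O.mHi + O.yLo) -
      max (max O.xLo (O.sLo - O.yLo)) (O.mLo + O.yLo)),
    max 0 (min (min O.yHi (O.sHi - O.xLo)) (O.xLo - O.mLo) -
      max (max O.yLo (O.sLo - O.xLo)) (O.xLo - O.mHi)),
    max 0 (min (min O.xHi (O.sHi - O.yHi)) (O.mHi + O.yHi) -
      max (max O.xLo (O.sLo - O.yHi)) (O.mLo + O.yHi)),
    max 0 (min (min O.yHi (O.sHi - O.xHi)) (O.xHi - O.mLo) -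
      max (max O.yLo (O.sLo - O.xHi)) (O.xHi - O.mHi))]

/-- Lengths `D_i` of the four diagonal sides (lower-left, upper-left, upper-right, lower-right). -/
noncomputable def D (O : Oct) : Fin 4 → ℝ :=
  ![Real.sqrt 2 * max 0 (min (min O.xHi (O.sLo - O.yLo)) ((O.mHi + O.sLo) / 2) -
      max (max O.xLo (O.sLo - O.yHi)) ((O.mLo + O.sLo) / 2)),
    Real.sqrt 2 * max 0 (min (min O.xHi (O.mLo + O.yHi)) ((O.sHi + O.mLo) / 2) -
      max (max O.xLo (O.mLo + O.yLo)) ((O.sLo + O.mLo) / 2)),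
    Real.sqrt 2 * max 0 (min (min O.xHi (O.sHi - O.yLo)) ((O.mHi + O.sHi) / 2) -
      max (max O.xLo (O.sHi - O.yHi)) ((O.mLo + O.sHi) / 2)),
    Real.sqrt 2 * max 0 (min (min O.xHi (O.mHi + O.yHi)) ((O.sHi + O.mHi) / 2) -
      max (max O.xLo (O.mHi + O.yLo)) ((O.sLo + O.mHi) / 2))]

/-- The positions of the four diagonal supporting lines. -/
def diagPos (O : Oct) : Fin 4 → ℝ := ![O.sLo, O.mLo, O.sHi, O.mHi]

/-- A nondegenerate octagon: all eight sides have positive length. -/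
def Nondeg (O : Oct) : Prop := (∀ i, 0 < O.P i) ∧ (∀ i, 0 < O.D i)

/-- The region is an (axis-parallel, possibly degenerate) rectangle. -/
def IsRect (O : Oct) : Prop :=
  ∃ x₁ x₂ y₁ y₂ : ℝ, O.region = {z : ℝ × ℝ | x₁ ≤ z.1 ∧ z.1 ≤ x₂ ∧ y₁ ≤ z.2 ∧ z.2 ≤ y₂}

end Oct

/-- A discrete octagon: the trace on the lattice of an octagon of the class `𝒲`
(some sides may have zero length). -/
def IsDiscreteOctagon (I : Set Pt) : Prop :=
  ∃ O : Oct, O.region.Nonempty ∧ I = {p : Pt | ((p.1 : ℝ), (p.2 : ℝ)) ∈ O.region}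

/-- `A_I ⊆ O`. -/
def OctContains (O : Oct) (ε : ℝ) (I : Set Pt) : Prop := Aset ε I ⊆ O.region

/-- `O` is the smallest octagon of the class `𝒲` containing `A_I`. -/
def OctMinimal (O : Oct) (ε : ℝ) (I : Set Pt) : Prop :=
  OctContains O ε I ∧ ∀ O' : Oct, OctContains O' ε I → O.region ⊆ O'.region

/-- Extremal coordinates of a (finite nonempty) set of lattice points. -/
noncomputable def xmin (S : Set Pt) : ℤ := sInf (Prod.fst '' S)
noncomputable def xmax (S : Set Pt) : ℤ := sSup (Prod.fst '' S)
noncomputable def ymin (S : Set Pt) : ℤ := sInf (Prod.snd '' S)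
noncomputable def ymax (S : Set Pt) : ℤ := sSup (Prod.snd '' S)

/-- Displacements (in lattice units) `α_i = a_i/ε` of the four axis-parallel sides
(bottom, left, top, right) between `I` and `I' ⊆ I`. -/
noncomputable def alpha (I I' : Set Pt) : Fin 4 → ℤ :=
  ![ymin I' - ymin I, xmin I' - xmin I, ymax I - ymax I', xmax I - xmax I']

/-- The four extreme slices `𝒫_i` (bottom, left, top, right) of `S`. -/
def extSlice (S : Set Pt) : Fin 4 → Set Pt :=
  ![{p ∈ S | ∀ q ∈ S, p.2 ≤ q.2}, {p ∈ S | ∀ q ∈ S, p.1 ≤ q.1},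
    {p ∈ S | ∀ q ∈ S, q.2 ≤ p.2}, {p ∈ S | ∀ q ∈ S, q.1 ≤ p.1}]

/-- The four diagonal sides `𝒟_i` (lower-left, upper-left, upper-right, lower-right) of a
discrete octagon `S`. -/
def diagSlice (S : Set Pt) : Fin 4 → Set Pt :=
  ![{p ∈ S | ∀ q ∈ S, p.1 + p.2 ≤ q.1 + q.2}, {p ∈ S | ∀ q ∈ S, q.2 - q.1 ≤ p.2 - p.1},
    {p ∈ S | ∀ q ∈ S, q.1 + q.2 ≤ p.1 + p.2}, {p ∈ S | ∀ q ∈ S, q.1 - q.2 ≤ p.1 - p.2}]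

/-- The four corner components `T_i` of `R_S ∖ S` for a discrete octagon `S`. -/
def Tcorner (S : Set Pt) : Fin 4 → Set Pt :=
  ![{p | p ∈ Rbox S ∧ p ∉ S ∧ ∀ q ∈ S, p.1 + p.2 < q.1 + q.2},
    {p | p ∈ Rbox S ∧ p ∉ S ∧ ∀ q ∈ S, q.2 - q.1 < p.2 - p.1},
    {p | p ∈ Rbox S ∧ p ∉ S ∧ ∀ q ∈ S, q.1 + q.2 < p.1 + p.2},
    {p | p ∈ Rbox S ∧ p ∉ S ∧ ∀ q ∈ S, q.1 - q.2 < p.1 - p.2}]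

/-- `I` is an `ε`-quasi-rectangle with inner octagon `Itil` and corner decorations `Δ`. -/
def IsQuasiRectWith (ε : ℝ) (C : ℕ) (I Itil : Set Pt) (Δ : Fin 4 → Set Pt) : Prop :=
  IsStaircase I ∧
  I = Itil ∪ (⋃ i, extSlice I i) ∪ (⋃ i, Δ i) ∧
  IsDiscreteOctagon Itil ∧
  Itil ⊆ I \ (⋃ i, extSlice I i) ∧
  (∀ i : Fin 4,
    (diagSlice Itil i).ncard = max (⌈4 * Real.sqrt (C : ℝ)⌉₊) (⌈ε ^ (-(7 : ℝ) / 8)⌉₊)) ∧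
  (∀ i : Fin 4, Δ i ⊆ Tcorner Itil i) ∧
  StronglyConnected (Itil ∪ ⋃ i, Δ i)

def IsQuasiRect (ε : ℝ) (C : ℕ) (I : Set Pt) : Prop :=
  ∃ Itil Δ, IsQuasiRectWith ε C I Itil Δ

/-- Good minimizers. -/
def GoodMinimizer (ε k ζ γ : ℝ) (C : ℕ) (u₁ u₀ : Config) : Prop :=
  Minimizes ε k ζ γ u₁ u₀ ∧
  (IsQuasiRect ε C (Iset u₀) →
    ∃ Itil Δ, IsQuasiRectWith ε C (Iset u₁) Itil Δ ∧
      ∀ p ∈ Ocorner (Iset u₁) ∩ Rbox Itil,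
        dB p (Iset u₀) ≤ ENNReal.ofReal
          (((min (min (alpha (Iset u₀) (Iset u₁) 0) (alpha (Iset u₀) (Iset u₁) 1))
              (min (alpha (Iset u₀) (Iset u₁) 2) (alpha (Iset u₀) (Iset u₁) 3)) : ℤ) : ℝ)))

/-- Distance of a real number from `ℕ`. -/
noncomputable def distToNat (x : ℝ) : ℝ := ⨅ n : ℕ, |x - (n : ℝ)|

/-- The differential inclusion for the velocity of an axis-parallel side of length `Pl`. -/
def PVel (ζ k v Pl : ℝ) : Prop :=
  ((¬ ∃ n : ℕ, (n : ℝ) = 2 * ζ * (1 - k) / Pl) →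
      v = (1 / ζ) * ((⌊2 * ζ * (1 - k) / Pl⌋ : ℤ) : ℝ)) ∧
  ((∃ n : ℕ, (n : ℝ) = 2 * ζ * (1 - k) / Pl) →
      v ∈ Set.Icc (2 * (1 - k) / Pl - 1 / ζ) (2 * (1 - k) / Pl))

/-- The differential inclusion for the velocity of a diagonal side of length `Dl`. -/
def DVel (ζ k v Dl : ℝ) : Prop :=
  ((¬ ∃ n : ℕ, (n : ℝ) = 2 * Real.sqrt 2 * ζ * (1 - k) / Dl) →
      v = (Real.sqrt 2 / (2 * ζ)) * ((⌊2 * Real.sqrt 2 * ζ * (1 - k) / Dl⌋ : ℤ) : ℝ)) ∧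
  ((∃ n : ℕ, (n : ℝ) = 2 * Real.sqrt 2 * ζ * (1 - k) / Dl) →
      v ∈ Set.Icc (2 * (1 - k) / Dl - Real.sqrt 2 / (2 * ζ)) (2 * (1 - k) / Dl))

/-- The differential inclusion for the velocity of a side of a rectangle of side length `Pl`
(the `γ < 2` regime). -/
def PVelRect (ζ k v Pl : ℝ) : Prop :=
  ((¬ ∃ n : ℕ, (n : ℝ) = 2 * ζ * (1 - k) / Pl) →
      v ∈ Set.Icc ((1 / ζ) * ((⌊2 * ζ * (1 - k) / Pl⌋ : ℤ) : ℝ))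
            ((1 / ζ) * ((⌈2 * ζ * (1 - k) / Pl⌉ : ℤ) : ℝ))) ∧
  ((∃ n : ℕ, (n : ℝ) = 2 * ζ * (1 - k) / Pl) →
      v ∈ Set.Icc (2 * (1 - k) / Pl - 1 / ζ) (2 * (1 - k) / Pl + 1 / ζ))


section LocalEnergy

lemma encard_eq_tsum {α : Type*} (s : Set α) :
    ((s.encard : ℕ∞) : ℝ≥0∞) = ∑' a, if a ∈ s then 1 else 0 := by
  rw [← ENNReal.tsum_set_one, tsum_subtype s (fun _ => (1 : ℝ≥0∞))]
  simp only [Set.indicator_apply]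

lemma d1_eq_zero_iff {p q : Pt} : d1 p q = 0 ↔ p = q := by
  simp only [d1, Prod.ext_iff]; omega

lemma d1_comm (p q : Pt) : d1 p q = d1 q p := by
  simp only [d1]; omega

lemma d1_self_add (p v : Pt) :
    d1 p (p + v) = 1 ↔ v ∈ ({(1, 0), (0, 1), (-1, 0), (0, -1)} : Finset Pt) := by
  simp only [d1, Prod.fst_add, Prod.snd_add, Finset.mem_insert, Finset.mem_singleton, Prod.ext_iff]
  omega

/-- The number of ordered nearest-neighbour pairs related by `R`, as a sum over horizontal and
vertical bonds. -/
lemma encard_adjacent_pairs (R : Pt → Pt → Prop) :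
    (({pq : Pt × Pt | R pq.1 pq.2 ∧ d1 pq.1 pq.2 = 1}.encard : ℕ∞) : ℝ≥0∞) =
      ∑' p : Pt, (((if R p (p + (1, 0)) then 1 else 0) + (if R (p + (1, 0)) p then 1 else 0)) +
        ((if R p (p + (0, 1)) then 1 else 0) + (if R (p + (0, 1)) p then 1 else 0))) := by
  have backward (e : Pt) : (∑' p : Pt, if R p (p + -e) then (1 : ℝ≥0∞) else 0) =
      ∑' p : Pt, if R (p + e) p then 1 else 0 := by
    rw [← (Equiv.addRight e).tsum_eq]
    simp
  calc (({pq : Pt × Pt | R pq.1 pq.2 ∧ d1 pq.1 pq.2 = 1}.encard : ℕ∞) : ℝ≥0∞)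
      = ∑' p : Pt, ∑' v : Pt, if R p (p + v) ∧ d1 p (p + v) = 1 then 1 else 0 := by
        rw [encard_eq_tsum, ENNReal.tsum_prod']
        refine tsum_congr fun p => ?_
        rw [← (Equiv.addLeft p).tsum_eq]
        refine tsum_congr fun v => ?_
        congr 1
    _ = ∑' v : Pt, ∑' p : Pt, if R p (p + v) ∧ d1 p (p + v) = 1 then 1 else 0 :=
        ENNReal.tsum_comm
    _ = ∑ v ∈ ({(1, 0), (0, 1), (-1, 0), (0, -1)} : Finset Pt),
          ∑' p : Pt, if R p (p + v) then 1 else 0 := by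
        rw [tsum_eq_sum (s := ({(1, 0), (0, 1), (-1, 0), (0, -1)} : Finset Pt))]
        · refine Finset.sum_congr rfl fun v hv => tsum_congr fun p => ?_
          simp only [(d1_self_add p v).2 hv, and_true]
        · intro v hv
          simp only [d1_self_add, hv, and_false, if_false, tsum_zero]
    _ = _ := by
        have h₁ := backward (1, 0)
        have h₂ := backward (0, 1)
        simp only [Prod.neg_mk, neg_zero] at h₁ h₂
        rw [Finset.sum_insert (by decide), Finset.sum_insert (by decide),
          Finset.sum_insert (by decide), Finset.sum_singleton, h₁, h₂,
          ENNReal.tsum_add, ENNReal.tsum_add, ENNReal.tsum_add]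
        ring

/-- Twice the number of bonds touching `A` is four times the number of points of `A` plus the number
of boundary edges. -/
lemma two_mul_tsum_bonds (A : Set Pt) :
    2 * ∑' p : Pt, ((if p ∈ A ∨ p + (1, 0) ∈ A then (1 : ℝ≥0∞) else 0) +
        (if p ∈ A ∨ p + (0, 1) ∈ A then 1 else 0)) =
      4 * (A.encard : ℝ≥0∞) +
        ({pq : Pt × Pt | pq.1 ∈ A ∧ pq.2 ∉ A ∧ d1 pq.1 pq.2 = 1}.encard : ℝ≥0∞) := by
  have shift (e : Pt) : (A.encard : ℝ≥0∞) = ∑' p : Pt, if p + e ∈ A then 1 else 0 := by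
    rw [encard_eq_tsum, ← (Equiv.addRight e).tsum_eq]
    rfl
  have hP := encard_adjacent_pairs fun p q => p ∈ A ∧ q ∉ A
  simp only [and_assoc] at hP
  have h4 : 4 * (A.encard : ℝ≥0∞) = (A.encard + A.encard) + (A.encard + A.encard) := by ring
  rw [hP, h4]
  nth_rewrite 2 [shift (1, 0)]
  nth_rewrite 3 [shift (0, 1)]
  rw [encard_eq_tsum, ← ENNReal.tsum_add, ← ENNReal.tsum_add, ← ENNReal.tsum_add,
    ← ENNReal.tsum_add, ← ENNReal.tsum_mul_left]
  refine tsum_congr fun p => ?_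
  by_cases h₀ : p ∈ A <;> by_cases h₁ : p + (1, 0) ∈ A <;> by_cases h₂ : p + (0, 1) ∈ A <;>
    simp only [h₀, h₁, h₂, or_true, or_false, and_true, and_false, not_true, not_false_eq_true,
      if_true, if_false] <;> norm_num

variable {ε k : ℝ} {u : Config}

lemma bond_of_eq_zero {a b : ℤ} (h : a = 0 ∨ b = 0) :
    bond ε k a b = ENNReal.ofReal (ε * (1 - k)) := by
  rcases h with rfl | rfl <;> simp [bond]

lemma bond_one_one : bond ε k 1 1 = 0 := by simp [bond]

lemma localEnergy_of_subset_Zset (hε : 0 < ε) (hk : k < 1) {A : Set Pt} (hA : A ⊆ Zset u) :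
    localEnergy ε k u A = ENNReal.ofReal (2 * ε * (1 - k)) * (A.encard : ℝ≥0∞) +
      ENNReal.ofReal ((1 - k) / 2) * perim ε A := by
  have term (p q : Pt) : (if p ∈ A ∨ q ∈ A then bond ε k (u.val p) (u.val q) else 0) =
      ENNReal.ofReal (ε * (1 - k)) * if p ∈ A ∨ q ∈ A then 1 else 0 := by
    split_ifs with h
    · rw [bond_of_eq_zero (h.imp (@hA p) (@hA q)), mul_one]
    · rw [mul_zero]
  have hk' : 0 ≤ 1 - k := by linarith
  have h₁ : ENNReal.ofReal (ε * (1 - k)) = ENNReal.ofReal (ε * (1 - k) / 2) * 2 := by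
    rw [← ENNReal.ofReal_ofNat 2, ← ENNReal.ofReal_mul (by positivity)]
    congr 1; ring
  have h₂ : ENNReal.ofReal (2 * ε * (1 - k)) = ENNReal.ofReal (ε * (1 - k) / 2) * 4 := by
    rw [← ENNReal.ofReal_ofNat 4, ← ENNReal.ofReal_mul (by positivity)]
    congr 1; ring
  have h₃ : ENNReal.ofReal (ε * (1 - k) / 2) =
      ENNReal.ofReal ((1 - k) / 2) * ENNReal.ofReal ε := by
    rw [← ENNReal.ofReal_mul (by positivity)]
    congr 1; ring
  simp only [localEnergy, term, ← mul_add]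
  rw [ENNReal.tsum_mul_left, h₁, mul_assoc, two_mul_tsum_bonds, mul_add, ← mul_assoc, ← h₂, h₃,
    perim, mul_assoc (ENNReal.ofReal _) (ENNReal.ofReal _)]

lemma mem_bdryIn_of_adjacent {G : Set Pt} {p q : Pt} (hp : p ∈ G) (hq : q ∉ G) (h : d1 p q = 1) :
    p ∈ bdryIn G := by
  refine ⟨hp, ?_⟩
  rw [dB, if_pos hp, distTo]
  refine le_antisymm (iInf₂_le_of_le q hq (by simp [h])) (le_iInf₂ fun r hr => ?_)
  have : 1 ≤ d1 p r :=
    Nat.one_le_iff_ne_zero.2 fun h0 => hr (d1_eq_zero_iff.1 h0 ▸ hp)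
  exact_mod_cast this

lemma stComp_subset {S : Set Pt} {p : Pt} (hp : p ∈ S) : stComp S p ⊆ S := by
  intro q hq
  rcases Relation.ReflTransGen.cases_tail hq with rfl | ⟨r, -, h⟩
  exacts [hp, h.2.1]

lemma not_mem_Zset_of_mem_Iset {p : Pt} (hp : p ∈ Iset u) : p ∉ Zset u := by
  simp only [Iset, Zset, Set.mem_ofPred_eq] at *
  omega

lemma mem_of_adjacent {G : Set Pt} (hbd : bdryIn G ⊆ Zset u) {p q : Pt} (hp : p ∈ G)
    (hpI : p ∈ Iset u) (h : d1 p q = 1) : q ∈ G := by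
  by_contra hq
  exact not_mem_Zset_of_mem_Iset hpI (hbd (mem_bdryIn_of_adjacent hp hq h))

lemma localEnergy_inter_Zset {G : Set Pt} (hG : G ⊆ Zset u ∪ Iset u) (hbd : bdryIn G ⊆ Zset u) :
    localEnergy ε k u (G ∩ Zset u) = localEnergy ε k u G := by
  have bulk {p q : Pt} (h : d1 p q = 1) (hp : p ∈ G) (hpZ : p ∉ G ∩ Zset u)
      (hqZ : q ∉ G ∩ Zset u) : u.val p = 1 ∧ u.val q = 1 := by
    have hpI : p ∈ Iset u := (hG hp).resolve_left fun hz => hpZ ⟨hp, hz⟩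
    have hq : q ∈ G := mem_of_adjacent hbd hp hpI h
    exact ⟨hpI, (hG hq).resolve_left fun hz => hqZ ⟨hq, hz⟩⟩
  have term {p q : Pt} (h : d1 p q = 1) :
      (if p ∈ G ∩ Zset u ∨ q ∈ G ∩ Zset u then bond ε k (u.val p) (u.val q) else 0) =
        if p ∈ G ∨ q ∈ G then bond ε k (u.val p) (u.val q) else 0 := by
    by_cases hZ : p ∈ G ∩ Zset u ∨ q ∈ G ∩ Zset u
    · rw [if_pos hZ, if_pos (hZ.imp And.left And.left)]
    · rw [if_neg hZ]
      split_ifs with hpq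
      · rw [not_or] at hZ
        have h1 : u.val p = 1 ∧ u.val q = 1 := by
          rcases hpq with hp | hq
          · exact bulk h hp hZ.1 hZ.2
          · exact (bulk (d1_comm p q ▸ h) hq hZ.2 hZ.1).symm
        rw [h1.1, h1.2, bond_one_one]
      · rfl
  refine tsum_congr fun p => congrArg₂ (· + ·) ?_ ?_
  · convert term ((d1_self_add p (1, 0)).2 (by decide))
  · convert term ((d1_self_add p (0, 1)).2 (by decide))

lemma perim_inter_Zset {G : Set Pt} (hG : G ⊆ Zset u ∪ Iset u) (hbd : bdryIn G ⊆ Zset u) :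
    perim ε (G ∩ Zset u) = perim ε G + compPerimSum ε (Iset u ∩ G) := by
  have key : {pq : Pt × Pt | pq.1 ∈ G ∩ Zset u ∧ pq.2 ∉ G ∩ Zset u ∧ d1 pq.1 pq.2 = 1} =
      {pq : Pt × Pt | pq.1 ∈ G ∧ pq.2 ∉ G ∧ d1 pq.1 pq.2 = 1} ∪
        Prod.swap '' {pq : Pt × Pt | pq.1 ∈ Iset u ∩ G ∧ pq.2 ∉ stComp (Iset u ∩ G) pq.1 ∧
          d1 pq.1 pq.2 = 1} := by
    ext ⟨p, q⟩
    simp only [Set.image_swap_eq_preimage_swap, Set.mem_union, Set.mem_preimage, Set.mem_ofPred_eq,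
      Prod.swap_prod_mk]
    constructor
    · rintro ⟨⟨hp, hpZ⟩, hq, h⟩
      by_cases hqG : q ∈ G
      · have hqI : q ∈ Iset u := (hG hqG).resolve_left fun hz => hq ⟨hqG, hz⟩
        exact .inr ⟨⟨hqI, hqG⟩,
          fun hc => not_mem_Zset_of_mem_Iset (stComp_subset (S := Iset u ∩ G) ⟨hqI, hqG⟩ hc).1 hpZ, d1_comm p q ▸ h⟩
      · exact .inl ⟨hp, hqG, h⟩
    · rintro (⟨hp, hq, h⟩ | ⟨⟨hqI, hqG⟩, hp, h⟩)
      · exact ⟨⟨hp, hbd (mem_bdryIn_of_adjacent hp hq h)⟩, fun hc => hq hc.1, h⟩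
      · have hpG : p ∈ G := mem_of_adjacent hbd hqG hqI h
        have hpI : p ∉ Iset u := fun hI => hp (.single ⟨⟨hqI, hqG⟩, ⟨hI, hpG⟩, h⟩)
        exact ⟨⟨hpG, (hG hpG).resolve_right hpI⟩,
          fun hc => not_mem_Zset_of_mem_Iset hqI hc.2, d1_comm p q ▸ h⟩
  have disj : Disjoint {pq : Pt × Pt | pq.1 ∈ G ∧ pq.2 ∉ G ∧ d1 pq.1 pq.2 = 1}
      (Prod.swap '' {pq : Pt × Pt | pq.1 ∈ Iset u ∩ G ∧ pq.2 ∉ stComp (Iset u ∩ G) pq.1 ∧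
        d1 pq.1 pq.2 = 1}) := by
    rw [Set.disjoint_left]
    rintro _ ⟨-, hq, -⟩ ⟨pq, ⟨⟨-, hG'⟩, -⟩, rfl⟩
    exact hq hG'
  rw [perim, perim, compPerimSum, key, Set.encard_union_eq disj,
    Prod.swap_injective.encard_image, ENat.toENNReal_add, mul_add]

end LocalEnergy

/-- Lemma 3.6: energy of a set of surfactant. -/
theorem statement3 (ε k : ℝ) (hε : 0 < ε) (hk₁ : 1 / 3 < k) (hk₂ : k < 1) (u : Config) :
    (localEnergy ε k u (Zset u) =
      ENNReal.ofReal (2 * ε * (1 - k) * ((Zset u).ncard : ℝ)) +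
        ENNReal.ofReal ((1 - k) / 2) * perim ε (Zset u)) ∧
    (∀ G : Set Pt, (∃ p₀ ∈ Zset u ∪ Iset u, G = stComp (Zset u ∪ Iset u) p₀) →
      bdryIn G ⊆ Zset u →
      localEnergy ε k u G =
        ENNReal.ofReal (2 * ε * (1 - k)) * ((G ∩ Zset u).encard : ℝ≥0∞) +
          ENNReal.ofReal ((1 - k) / 2) *
            (perim ε G + compPerimSum ε (Iset u ∩ G))) := by
  refine ⟨?_, ?_⟩
  · have hk : 0 ≤ 1 - k := by linarith
    have hfin : (Zset u).Finite := u.finiteZero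
    rw [localEnergy_of_subset_Zset hε hk₂ subset_rfl,
      ENNReal.ofReal_mul (p := 2 * ε * (1 - k)) (by positivity), ENNReal.ofReal_natCast,
      ← hfin.cast_ncard_eq, ENat.toENNReal_coe]
  · rintro G ⟨p₀, hp₀, rfl⟩ hbd
    have hG := stComp_subset hp₀
    rw [← localEnergy_inter_Zset hG hbd, localEnergy_of_subset_Zset hε hk₂ Set.inter_subset_right,
      perim_inter_Zset hG hbd]

end BEG
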